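/- In the setting of the feedback refinement relation construction (R a feedback refinement relation from Σ₁ to Σ₂ with Q₁ = R⁻¹(Q₂), T₁ = R⁻¹(T₂), #R(x₁) = 1 for all x₁ ∈ X₁, and R⁻¹(x₂) ≠ ∅ for all x₂ ∈ Q₂), the map A₂ ↦ R⁻¹(A₂) is injective on 𝒜₂ (R⁻¹(A₂) ≠ R⁻¹(Ã₂) whenever A₂ ≠ Ã₂ in 𝒜₂), and for the induced reach-spanning set ℛ₁ := {(R⁻¹(α(j)))_{j=0}^{τ−1} : α ∈ ℛ₂}, one has #P̂_{ℛ₁}(α₁|_{[0;t]}) = #P̂_{ℛ₂}(α₂|_{[0;t]}) for corresponding sequences and all admissible t, #ℛ_{1,0} = #ℛ_{2,0}, and consequently N(ℛ₁) = N(ℛ₂). -/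

import Mathlib

open scoped Classical ENNReal

/-- The element at index `t` of a finite sequence of sets (default `∅`). -/
def seqGet {X : Type*} (α : List (Set X)) (t : ℕ) : Set X := α.getD t ∅

/-- `𝒜` is a finite cover of `B`: a finite set of subsets of `B` whose union is `B`. -/
def IsCover {X : Type*} (𝒜 : Set (Set X)) (B : Set X) : Prop :=
  𝒜.Finite ∧ (∀ A ∈ 𝒜, A ⊆ B) ∧ ⋃₀ 𝒜 = B

/-- The set `P_ℛ` of successor cover elements of the prefix `pre = α|_[0;t]`
(of length `t + 1`). -/
def PSucc {X : Type*} (𝒜 : Set (Set X)) (T : Set X) (ℛ : Set (List (Set X)))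
    (pre : List (Set X)) : Set (Set X) :=
  {A | (A ∈ 𝒜 ∨ A = T) ∧
    ∃ β ∈ ℛ, β.take pre.length = pre ∧ pre.length < β.length ∧ seqGet β pre.length = A}

/-- `ℛ` is a `(Q,T)`-reach-spanning set in `(𝒜, G)`. -/
def ReachSpanning {X U : Type*} (F : X → U → Set X) (Q T : Set X)
    (𝒜 : Set (Set X)) (G : List (Set X) → U) (ℛ : Set (List (Set X))) : Prop :=
  ℛ.Finite ∧
  (∀ α ∈ ℛ, α ≠ [] ∧ ∀ A ∈ α, A ⊆ Q) ∧
  (Q = ⋃ α ∈ ℛ, seqGet α 0) ∧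
  (∀ α ∈ ℛ, (∀ t, t + 2 ≤ α.length → seqGet α t ∈ 𝒜) ∧ seqGet α (α.length - 1) = T) ∧
  (∀ α ∈ ℛ, ∀ t, t + 2 ≤ α.length →
    (⋃ x ∈ seqGet α t, F x (G (α.take (t + 1)))) ⊆ ⋃ A ∈ PSucc 𝒜 T ℛ (α.take (t + 1)), A)

/-- The set `ℛ₀` of first elements of members of `ℛ`, excluding the target set `T`. -/
def R0 {X : Type*} (T : Set X) (ℛ : Set (List (Set X))) : Set (Set X) :=
  {A | (∃ α ∈ ℛ, seqGet α 0 = A) ∧ A ≠ T}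

/-- The quantity `B(α)`. -/
noncomputable def Bval {X : Type*} (𝒜 : Set (Set X)) (T : Set X)
    (ℛ : Set (List (Set X))) (α : List (Set X)) : ℝ :=
  if α.length ≤ 1 then 0
  else (1 / ((α.length : ℝ) - 1)) *
    ((∑ t ∈ Finset.range (α.length - 2),
        Real.logb 2 ((PSucc 𝒜 T ℛ (α.take (t + 1)) \ {T}).ncard)) +
      Real.logb 2 ((R0 T ℛ).ncard))

/-- The quantity `N(ℛ)`, the largest value of `B` on `ℛ`. -/
noncomputable def Nval {X : Type*} (𝒜 : Set (Set X)) (T : Set X)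
    (ℛ : Set (List (Set X))) : ℝ :=
  sSup (Bval 𝒜 T ℛ '' ℛ)

/-- The `(Q,T)`-reachability entropy, with value `⊤` if `(Q,T)`-reachability is not
satisfiable. -/
noncomputable def entropy {X U : Type*} (F : X → U → Set X) (Q T : Set X) : ℝ≥0∞ :=
  sInf {e | ∃ (𝒜 : Set (Set X)) (G : List (Set X) → U) (ℛ : Set (List (Set X))),
    IsCover 𝒜 (Q \ T) ∧ ReachSpanning F Q T 𝒜 G ℛ ∧
    e = ENNReal.ofReal (Nval 𝒜 T ℛ)}

/-- `(Q,T)`-reachability is satisfiable: every state in `Q` can be steered to `T` in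
finite time, never leaving `Q`, using a feedback strategy taking finitely many input
values. -/
def Satisfiable {X U : Type*} (F : X → U → Set X) (Q T : Set X) : Prop :=
  ∃ Uf : Set U, Uf.Finite ∧ ∃ κ : List X → U, (∀ xs, κ xs ∈ Uf) ∧
    ∀ ξ : ℕ → X, ξ 0 ∈ Q →
      (∀ t, (∀ k ≤ t, ξ k ∉ T) →
        ξ (t + 1) ∈ F (ξ t) (κ (List.ofFn fun i : Fin (t + 1) => ξ i))) →
      ∃ n, ξ n ∈ T ∧ ∀ t < n, ξ t ∈ Q \ T

/-- The image `R(B)` of a set `B ⊆ X₁` under the relation `R ⊆ X₁ × X₂`. -/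
def relImg {X₁ X₂ : Type*} (R : Set (X₁ × X₂)) (B : Set X₁) : Set X₂ :=
  {x₂ | ∃ x₁ ∈ B, (x₁, x₂) ∈ R}

/-- The preimage `R⁻¹(B)` of a set `B ⊆ X₂` under the relation `R ⊆ X₁ × X₂`. -/
def relPre {X₁ X₂ : Type*} (R : Set (X₁ × X₂)) (B : Set X₂) : Set X₁ :=
  {x₁ | ∃ x₂ ∈ B, (x₁, x₂) ∈ R}

/-- `R` is a feedback refinement relation from `Σ₁ = (X₁, U₁, F₁)` to
`Σ₂ = (X₂, U₂, F₂)`: `R` is strict and there is an interface map `r : U₂ → U₁` with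
`R(F₁(x₁, r(u))) ⊆ F₂(x₂, u)` for all `(x₁, x₂) ∈ R` and `u ∈ U₂`. -/
def IsFRR {X₁ U₁ X₂ U₂ : Type*} (F₁ : X₁ → U₁ → Set X₁) (F₂ : X₂ → U₂ → Set X₂)
    (R : Set (X₁ × X₂)) : Prop :=
  (∀ x₁, ∃ x₂, (x₁, x₂) ∈ R) ∧
  ∃ r : U₂ → U₁, ∀ x₁ x₂, (x₁, x₂) ∈ R → ∀ u : U₂,
    relImg R (F₁ x₁ (r u)) ⊆ F₂ x₂ u

theorem relPre_inj_aux {X₁ X₂ : Type*} (R : Set (X₁ × X₂)) (Q : Set X₂)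
    (hsingle : ∀ x₁, ∃! x₂, (x₁, x₂) ∈ R)
    (hsur : ∀ x₂ ∈ Q, ∃ x₁, (x₁, x₂) ∈ R) (A B : Set X₂) (hA : A ⊆ Q)
    (h : relPre R A ⊆ relPre R B) : A ⊆ B := by
  intro x hx
  obtain ⟨y, hy⟩ := hsur x (hA hx)
  obtain ⟨z, hz, hyz⟩ := h ⟨x, hx, hy⟩
  rwa [(hsingle y).unique hy hyz]

theorem seqGet_map_aux {X₁ X₂ : Type*} (R : Set (X₁ × X₂)) (α : List (Set X₂)) (t : ℕ) :
    seqGet (α.map (relPre R)) t = relPre R (seqGet α t) := by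
  have h : relPre R ∅ = ∅ := by ext x; simp [relPre]
  unfold seqGet
  rw [← h, List.getD_map]

theorem map_inj_aux {X Y : Type*} (f : X → Y) (S : Set X) (hf : Set.InjOn f S) :
    ∀ l m : List X, (∀ a ∈ l, a ∈ S) → (∀ a ∈ m, a ∈ S) → l.map f = m.map f → l = m
  | [], [], _, _, _ => rfl
  | [], _ :: _, _, _, h => by simp at h
  | _ :: _, [], _, _, h => by simp at h
  | a :: l, b :: m, hl, hm, h => by
    simp only [List.map_cons, List.cons.injEq] at h
    rw [hf (hl a (by simp)) (hm b (by simp)) h.1,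
      map_inj_aux f S hf l m (fun x hx => hl x (by simp [hx]))
        (fun x hx => hm x (by simp [hx])) h.2]

theorem seqGet_sub_aux {X : Type*} (Q : Set X) (α : List (Set X)) (h : ∀ A ∈ α, A ⊆ Q)
    (t : ℕ) : seqGet α t ⊆ Q := by
  unfold seqGet
  by_cases ht : t < α.length
  · rw [List.getD_eq_getElem _ _ ht]
    exact h _ (List.getElem_mem ht)
  · rw [List.getD_eq_default _ _ (by omega)]
    exact Set.empty_subset _

/-- In the feedback-refinement construction, the map
`A₂ ↦ R⁻¹(A₂)` is injective on `𝒜₂`, the induced reach-spanning set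
`ℛ₁ = {(R⁻¹(α(j)))_j : α ∈ ℛ₂}` satisfies
`#P̂_{ℛ₁}(α₁|_[0;t]) = #P̂_{ℛ₂}(α₂|_[0;t])` for corresponding sequences and all
admissible `t`, `#ℛ_{1,0} = #ℛ_{2,0}`, and consequently `N(ℛ₁) = N(ℛ₂)`. -/
theorem Nval_preimage_of_FRR {X₁ U₁ X₂ U₂ : Type*}
    [Nonempty X₁] [Nonempty U₁] [Nonempty X₂] [Nonempty U₂]
    (F₁ : X₁ → U₁ → Set X₁) (F₂ : X₂ → U₂ → Set X₂)
    (hF₁ : ∀ x u, (F₁ x u).Nonempty) (hF₂ : ∀ x u, (F₂ x u).Nonempty)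
    (Q₁ T₁ : Set X₁) (Q₂ T₂ : Set X₂)
    (hT₁ne : T₁.Nonempty) (hT₂ne : T₂.Nonempty)
    (hT₁Q₁ : T₁ ⊆ Q₁) (hT₂Q₂ : T₂ ⊆ Q₂)
    (R : Set (X₁ × X₂)) (r : U₂ → U₁)
    (hRstrict : ∀ x₁, ∃ x₂, (x₁, x₂) ∈ R)
    (hfrr : ∀ x₁ x₂, (x₁, x₂) ∈ R → ∀ u : U₂, relImg R (F₁ x₁ (r u)) ⊆ F₂ x₂ u)
    (hQ : Q₁ = relPre R Q₂) (hT : T₁ = relPre R T₂)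
    (hsingle : ∀ x₁, ∃! x₂, (x₁, x₂) ∈ R)
    (hsur : ∀ x₂ ∈ Q₂, ∃ x₁, (x₁, x₂) ∈ R)
    (𝒜₂ : Set (Set X₂)) (G₂ : List (Set X₂) → U₂) (ℛ₂ : Set (List (Set X₂)))
    (hcov₂ : IsCover 𝒜₂ (Q₂ \ T₂)) (hspan₂ : ReachSpanning F₂ Q₂ T₂ 𝒜₂ G₂ ℛ₂) :
    (∀ A₂ ∈ 𝒜₂, ∀ A₂' ∈ 𝒜₂, relPre R A₂ = relPre R A₂' → A₂ = A₂') ∧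
    (∀ α ∈ ℛ₂, ∀ t, t + 2 ≤ α.length →
      (PSucc (relPre R '' 𝒜₂) T₁ (List.map (relPre R) '' ℛ₂)
          ((α.take (t + 1)).map (relPre R)) \ {T₁}).ncard
        = (PSucc 𝒜₂ T₂ ℛ₂ (α.take (t + 1)) \ {T₂}).ncard) ∧
    (R0 T₁ (List.map (relPre R) '' ℛ₂)).ncard = (R0 T₂ ℛ₂).ncard ∧
    Nval (relPre R '' 𝒜₂) T₁ (List.map (relPre R) '' ℛ₂) = Nval 𝒜₂ T₂ ℛ₂ := by
  obtain ⟨hc1, hc2, -⟩ := hcov₂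
  obtain ⟨-, hsub, -, -, -⟩ := hspan₂
  have hinj : Set.InjOn (relPre R) {A | A ⊆ Q₂} := fun A hA B hB h =>
    Set.Subset.antisymm (relPre_inj_aux R Q₂ hsingle hsur A B hA h.le)
      (relPre_inj_aux R Q₂ hsingle hsur B A hB h.ge)
  have hAQ : ∀ A ∈ 𝒜₂, A ⊆ Q₂ := fun A hA => (hc2 A hA).trans Set.diff_subset
  have hget : ∀ α ∈ ℛ₂, ∀ t, seqGet α t ⊆ Q₂ := fun α hα t =>
    seqGet_sub_aux Q₂ α (hsub α hα).2 t
  have hP : ∀ α ∈ ℛ₂, ∀ t,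
      (PSucc (relPre R '' 𝒜₂) T₁ (List.map (relPre R) '' ℛ₂)
          ((α.take (t + 1)).map (relPre R)) \ {T₁}).ncard
        = (PSucc 𝒜₂ T₂ ℛ₂ (α.take (t + 1)) \ {T₂}).ncard := by
    intro α hα t
    have hpre : ∀ A ∈ α.take (t + 1), A ⊆ Q₂ := fun A hA =>
      (hsub α hα).2 A (List.mem_of_mem_take hA)
    generalize α.take (t + 1) = pre at hpre
    have himg : PSucc (relPre R '' 𝒜₂) T₁ (List.map (relPre R) '' ℛ₂)
          (pre.map (relPre R)) \ {T₁} = relPre R '' (PSucc 𝒜₂ T₂ ℛ₂ pre \ {T₂}) := by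
      ext A
      constructor
      · rintro ⟨⟨hA, _, ⟨β, hβ, rfl⟩, h1, h2, h3⟩, hne⟩
        simp only [List.length_map] at h1 h2 h3
        rw [seqGet_map_aux] at h3
        rw [← List.map_take] at h1
        have h1' := map_inj_aux (relPre R) _ hinj _ _
          (fun A hA => (hsub β hβ).2 A (List.mem_of_mem_take hA)) hpre h1
        have hneT : seqGet β pre.length ≠ T₂ := by
          intro h
          apply hne
          rw [Set.mem_singleton_iff, ← h3, h, hT]
        refine ⟨seqGet β pre.length, ⟨⟨?_, β, hβ, h1', h2, rfl⟩, hneT⟩, h3⟩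
        rcases hA with ⟨B, hB, hBA⟩ | hA
        · left
          rwa [hinj (hget β hβ _) (hAQ B hB) (h3.trans hBA.symm)]
        · exact absurd hA hne
      · rintro ⟨B, ⟨⟨hB, β, hβ, h1, h2, h3⟩, hne⟩, rfl⟩
        refine ⟨⟨?_, _, ⟨β, hβ, rfl⟩, ?_, ?_, ?_⟩, ?_⟩
        · rcases hB with hB | hB
          · exact Or.inl ⟨B, hB, rfl⟩
          · exact absurd hB hne
        · rw [List.length_map, ← List.map_take, h1]
        · simpa using h2
        · rw [List.length_map, seqGet_map_aux, h3]
        · intro h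
          rw [Set.mem_singleton_iff, hT] at h
          exact hne (hinj (h3 ▸ hget β hβ _) hT₂Q₂ h)
    rw [himg]
    apply Set.ncard_image_of_injOn
    apply hinj.mono
    rintro B ⟨⟨_, β, hβ, _, _, rfl⟩, _⟩
    exact hget β hβ _
  have hR : (R0 T₁ (List.map (relPre R) '' ℛ₂)).ncard = (R0 T₂ ℛ₂).ncard := by
    have himg : R0 T₁ (List.map (relPre R) '' ℛ₂) = relPre R '' R0 T₂ ℛ₂ := by
      ext A
      constructor
      · rintro ⟨⟨_, ⟨β, hβ, rfl⟩, h3⟩, hne⟩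
        rw [seqGet_map_aux] at h3
        refine ⟨seqGet β 0, ⟨⟨β, hβ, rfl⟩, ?_⟩, h3⟩
        intro h
        exact hne (by rw [← h3, h, hT])
      · rintro ⟨_, ⟨⟨β, hβ, rfl⟩, hne⟩, rfl⟩
        refine ⟨⟨_, ⟨β, hβ, rfl⟩, seqGet_map_aux R β 0⟩, ?_⟩
        intro h
        rw [hT] at h
        exact hne (hinj (hget β hβ _) hT₂Q₂ h)
    rw [himg]
    apply Set.ncard_image_of_injOn
    apply hinj.mono
    rintro B ⟨⟨β, hβ, rfl⟩, _⟩
    exact hget β hβ _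
  refine ⟨fun A hA B hB h => hinj (hAQ A hA) (hAQ B hB) h, fun α hα t _ => hP α hα t, hR, ?_⟩
  unfold Nval
  rw [Set.image_image]
  congr 1
  apply Set.image_congr
  intro α hα
  unfold Bval
  rw [hR, List.length_map]
  simp only [← List.map_take, hP α hα]
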